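/- (Theorem 1, genuine-entanglement witness.) Let G = (V, E) be a finite simple graph with a proper k-coloring with color classes V_1, …, V_k, and let P_l = ∏_{i ∈ V_l} (S_i + I)/2. Let 𝒫 = {A_1, …, A_m} be a partition of V into m ≥ 2 nonempty parts. Then every 𝒫-bi-separable density matrix ρ satisfies Σ_{l=1}^k Tr(P_l ρ) ≤ k − 1 + max_A 2^{−r(A)}, where the maximum is over all nonempty proper unions of parts A of 𝒫; equivalently, Tr(W_b ρ) ≥ 0 for the witness W_b = (k − 1 + max_A 2^{−r(A)})·I − Σ_{l=1}^k P_l. -/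

import Mathlib

open Matrix Finset
open scoped Classical ComplexOrder

noncomputable section

variable {V : Type} [Fintype V] [DecidableEq V]

/-- The indicator function δ_i : V → ZMod 2 of a vertex `i`. -/
def delta (i : V) : V → ZMod 2 := fun v => if v = i then 1 else 0

/-- The stabilizer `S_i = X_i ⊗_{j ∈ N(i)} Z_j` of the graph `G` at vertex `i`,
as a matrix acting on the N-qubit Hilbert space `(V → ZMod 2) → ℂ`:
`(S_i ψ)(x) = (-1)^{∑_{j ∈ N(i)} x(j)} ψ(x + δ_i)`. -/
def stab (G : SimpleGraph V) (i : V) : Matrix (V → ZMod 2) (V → ZMod 2) ℂ :=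
  Matrix.of fun x y =>
    if y = x + delta i then ((-1 : ℂ) ^ (∑ j ∈ univ.filter (fun j => G.Adj i j), (x j).val))
    else 0

/-- The number of edges `{i,j}` of `G` with `x i = x j = 1`. -/
def edgeCount (G : SimpleGraph V) (x : V → ZMod 2) : ℕ :=
  (G.edgeFinset.filter (fun e => ∀ v ∈ e, x v = 1)).card

/-- The graph state of `G`: `g(x) = 2^{-N/2} (-1)^{e(x)}`. -/
def graphState (G : SimpleGraph V) : (V → ZMod 2) → ℂ :=
  fun x => ((-1 : ℂ) ^ edgeCount G x) / ((Real.sqrt 2 ^ Fintype.card V : ℝ) : ℂ)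

/-- The stabilizer projector `∏_{i ∈ W} (S_i + I)/2` (the factors pairwise commute, so
the order of multiplication is irrelevant; we use the canonical enumeration of `W`). -/
def stabProj (G : SimpleGraph V) (W : Finset V) : Matrix (V → ZMod 2) (V → ZMod 2) ℂ :=
  (W.toList.map (fun i => (2:ℂ)⁻¹ • (stab G i + 1))).prod

/-- The off-diagonal adjacency block `Γ_{A,Ā}` over `ZMod 2`. -/
def gammaMat (G : SimpleGraph V) (A : Finset V) :
    Matrix {v // v ∈ A} {v // v ∉ A} (ZMod 2) :=
  Matrix.of fun i j => if G.Adj i.1 j.1 then 1 else 0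

/-- `r(A)`: the rank of `Γ_{A,Ā}` over `ZMod 2`. -/
def gRank (G : SimpleGraph V) (A : Finset V) : ℕ := (gammaMat G A).rank

/-- Restriction of a computational-basis label to a subset `A`. -/
def restrictTo (A : Finset V) (x : V → ZMod 2) : {v // v ∈ A} → ZMod 2 := fun v => x v.1

/-- Restriction of a computational-basis label to the complement of `A`. -/
def restrictOut (A : Finset V) (x : V → ZMod 2) : {v // v ∉ A} → ZMod 2 := fun v => x v.1

/-- `ψ` is a product vector across the bipartition `{A, V \ A}`. -/
def IsProdVec (A : Finset V) (ψ : (V → ZMod 2) → ℂ) : Prop :=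
  ∃ (φ : ({v // v ∈ A} → ZMod 2) → ℂ) (χ : ({v // v ∉ A} → ZMod 2) → ℂ),
    ∀ x, ψ x = φ (restrictTo A x) * χ (restrictOut A x)

/-- `P : Fin m → Finset V` is a partition of `V` into `m` nonempty disjoint subsets. -/
def IsPartition {m : ℕ} (P : Fin m → Finset V) : Prop :=
  (∀ t, (P t).Nonempty) ∧ (∀ t t', t ≠ t' → Disjoint (P t) (P t')) ∧
    univ.biUnion P = univ

/-- `ψ` is a unit vector: `⟨ψ, ψ⟩ = 1`. -/
def IsUnit' (ψ : (V → ZMod 2) → ℂ) : Prop := star ψ ⬝ᵥ ψ = 1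

/-- A pure state fully separable with respect to the partition `P`:
`ψ(x) = ∏_t φ_t(x|_{A_t})`. -/
def FullSepPure {m : ℕ} (P : Fin m → Finset V) (ψ : (V → ZMod 2) → ℂ) : Prop :=
  ∃ φ : (t : Fin m) → ({v // v ∈ P t} → ZMod 2) → ℂ,
    ∀ x, ψ x = ∏ t, φ t (restrictTo (P t) x)

/-- A `P`-fully separable density matrix. -/
def FullSep {m : ℕ} (P : Fin m → Finset V) (ρ : Matrix (V → ZMod 2) (V → ZMod 2) ℂ) : Prop :=
  ∃ (M : ℕ) (p : Fin M → ℝ) (ψ : Fin M → ((V → ZMod 2) → ℂ)),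
    (∀ i, 0 ≤ p i) ∧ (∑ i, p i) = 1 ∧ (∀ i, IsUnit' (ψ i)) ∧
    (∀ i, FullSepPure P (ψ i)) ∧
    ρ = ∑ i, (p i : ℂ) • vecMulVec (ψ i) (star (ψ i))

/-- A `P`-bi-separable density matrix: a convex mixture of unit vectors each of which is a
product vector across `{A, V \ A}` for some nonempty proper union of parts `A` of `P`. -/
def BiSep {m : ℕ} (P : Fin m → Finset V) (ρ : Matrix (V → ZMod 2) (V → ZMod 2) ℂ) : Prop :=
  ∃ (M : ℕ) (p : Fin M → ℝ) (ψ : Fin M → ((V → ZMod 2) → ℂ)),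
    (∀ i, 0 ≤ p i) ∧ (∑ i, p i) = 1 ∧ (∀ i, IsUnit' (ψ i)) ∧
    (∀ i, ∃ S : Finset (Fin m), S.Nonempty ∧ S ≠ univ ∧ IsProdVec (S.biUnion P) (ψ i)) ∧
    ρ = ∑ i, (p i : ℂ) • vecMulVec (ψ i) (star (ψ i))

/-- An `m`-separable density matrix: a convex mixture of unit vectors each of which is
fully separable with respect to some partition of `V` into `m` nonempty parts. -/
def MSep (m : ℕ) (ρ : Matrix (V → ZMod 2) (V → ZMod 2) ℂ) : Prop :=
  ∃ (M : ℕ) (p : Fin M → ℝ) (ψ : Fin M → ((V → ZMod 2) → ℂ)),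
    (∀ i, 0 ≤ p i) ∧ (∑ i, p i) = 1 ∧ (∀ i, IsUnit' (ψ i)) ∧
    (∀ i, ∃ P : Fin m → Finset V, IsPartition P ∧ FullSepPure P (ψ i)) ∧
    ρ = ∑ i, (p i : ℂ) • vecMulVec (ψ i) (star (ψ i))

/-- A proper `k`-coloring of `G` with color classes `C 0, …, C (k-1)`:
the classes are disjoint, cover `V`, and each is an independent set. -/
def IsColoring (G : SimpleGraph V) {k : ℕ} (C : Fin k → Finset V) : Prop :=
  (∀ l l', l ≠ l' → Disjoint (C l) (C l')) ∧ univ.biUnion C = univ ∧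
    ∀ l, ∀ i ∈ C l, ∀ j ∈ C l, ¬ G.Adj i j

/-- A density matrix: Hermitian positive semidefinite with trace 1. -/
def IsDensity (ρ : Matrix (V → ZMod 2) (V → ZMod 2) ℂ) : Prop :=
  ρ.PosSemidef ∧ ρ.trace = 1

/-- Glue `a : A → ZMod 2` and `b : Ā → ZMod 2` into a function on `V`. -/
def glue (A : Finset V) (a : {v // v ∈ A} → ZMod 2) (b : {v // v ∉ A} → ZMod 2) :
    V → ZMod 2 := fun v => if h : v ∈ A then a ⟨v, h⟩ else b ⟨v, h⟩

/-- The reduced density matrix `ρ_A` of a pure state `ψ`. -/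
def rdm (A : Finset V) (ψ : (V → ZMod 2) → ℂ) :
    Matrix ({v // v ∈ A} → ZMod 2) ({v // v ∈ A} → ZMod 2) ℂ :=
  Matrix.of fun a a' => ∑ b : {v // v ∉ A} → ZMod 2,
    ψ (glue A a b) * (starRingEnd ℂ) (ψ (glue A a' b))


/-- The star graph on `Fin N` (center `0`, i.e. vertex labelled 1). -/
def starGraph (N : ℕ) : SimpleGraph (Fin N) :=
  SimpleGraph.fromRel (fun i _ => (i : ℕ) = 0)

/-- The path graph on `Fin N` (vertex `v` represents the label `v+1`). -/
def pathGraph (N : ℕ) : SimpleGraph (Fin N) :=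
  SimpleGraph.fromRel (fun a b => (a : ℕ) + 1 = (b : ℕ))

/-- The `n × n` grid graph. -/
def gridGraph (n : ℕ) : SimpleGraph (Fin n × Fin n) :=
  SimpleGraph.fromRel (fun a b => Nat.dist (a.1 : ℕ) (b.1 : ℕ) + Nat.dist (a.2 : ℕ) (b.2 : ℕ) = 1)

/-- The number of edges of `G` crossing the bipartition `{A, V \ A}` (each such edge is
counted once, as the ordered pair whose first component lies in `A`). -/
def crossCount {W : Type} [Fintype W] [DecidableEq W] (G : SimpleGraph W) (A : Finset W) : ℕ :=
  ((univ ×ˢ univ).filter fun p : W × W => G.Adj p.1 p.2 ∧ p.1 ∈ A ∧ p.2 ∉ A).card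

/-- The sign character `z ↦ (-1)^z` of `ZMod 2`. -/
def parSign (z : ZMod 2) : ℂ := (-1) ^ z.val

theorem parSign_zero : parSign 0 = 1 := by simp [parSign]

theorem parSign_one : parSign 1 = -1 := by simp [parSign, ZMod.val_one]

theorem zmod_two_eq (z : ZMod 2) : z = 0 ∨ z = 1 := by
  revert z; decide

theorem parSign_add (a b : ZMod 2) : parSign (a + b) = parSign a * parSign b := by
  have h : (1 : ZMod 2) + 1 = 0 := by decide
  rcases zmod_two_eq a with rfl | rfl <;> rcases zmod_two_eq b with rfl | rfl <;>
    simp [h, parSign_zero, parSign_one]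

theorem star_parSign (a : ZMod 2) : star (parSign a) = parSign a := by
  rcases zmod_two_eq a with rfl | rfl <;> simp [parSign_zero, parSign_one]

theorem norm_parSign (a : ZMod 2) : ‖parSign a‖ = 1 := by
  rcases zmod_two_eq a with rfl | rfl <;> simp [parSign_zero, parSign_one]

theorem parSign_sum {ι : Type*} (s : Finset ι) (f : ι → ZMod 2) :
    parSign (∑ j ∈ s, f j) = (-1) ^ ∑ j ∈ s, (f j).val := by
  induction s using Finset.induction_on with
  | empty => simp [parSign_zero]
  | insert a s ha ih => rw [sum_insert ha, sum_insert ha, parSign_add, ih, pow_add, parSign]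

/-- Orthogonality of characters of an elementary abelian 2-group. -/
theorem sum_parSign {M : Type*} [AddCommGroup M] [Fintype M] (L : M →+ ZMod 2) :
    ∑ x, parSign (L x) = if L = 0 then (Fintype.card M : ℂ) else 0 := by
  split_ifs with h
  · simp [h, parSign_zero]
  · obtain ⟨y, hy⟩ := DFunLike.ne_iff.mp h
    have hy1 : L y = 1 := (zmod_two_eq (L y)).resolve_left hy
    have h1 : ∑ x, parSign (L x) = ∑ x, parSign (L (x + y)) :=
      (Equiv.sum_comp (Equiv.addRight y) fun x => parSign (L x)).symm
    simp only [map_add, parSign_add, hy1, parSign_one, mul_neg, mul_one, sum_neg_distrib] at h1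
    exact self_eq_neg.mp h1

theorem sum_parSign_dotProduct {ι : Type*} [Fintype ι] [DecidableEq ι] (a : ι → ZMod 2) :
    ∑ x : ι → ZMod 2, parSign (x ⬝ᵥ a) = if a = 0 then (2 : ℂ) ^ Fintype.card ι else 0 := by
  let L : (ι → ZMod 2) →+ ZMod 2 :=
    { toFun := fun x => x ⬝ᵥ a, map_zero' := zero_dotProduct a
      map_add' := fun x y => add_dotProduct x y a }
  have hL : L = 0 ↔ a = 0 := by
    constructor
    · intro h
      ext i
      simpa [L] using congrArg ZMod.val (DFunLike.congr_fun h (Pi.single i 1))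
    · rintro rfl
      ext x
      simp [L]
  have := sum_parSign L
  simp only [hL] at this
  simpa [L] using this

/-- The adjacency matrix of `G` over `ZMod 2`, restricted to one orientation of each edge. -/
def upperAdj (G : SimpleGraph V) : Matrix V V (ZMod 2) :=
  Matrix.of fun u v =>
    if G.Adj u v ∧ Fintype.equivFin V u < Fintype.equivFin V v then 1 else 0

set_option linter.unusedSectionVars false in
theorem upperAdj_add_transpose (G : SimpleGraph V) :
    upperAdj G + (upperAdj G)ᵀ = Matrix.of fun u v => if G.Adj u v then 1 else 0 := by
  ext u v
  simp only [upperAdj, Matrix.add_apply, Matrix.transpose_apply, Matrix.of_apply]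
  by_cases h : G.Adj u v
  · have hne : Fintype.equivFin V u ≠ Fintype.equivFin V v := by simpa using h.ne
    rcases lt_or_gt_of_ne hne with h' | h'
    · simp [h, h.symm, h', h'.not_gt]
    · simp [h, h.symm, h', h'.not_gt]
  · simp [h, G.adj_comm v u]

/-- The parity of the number of edges of `G` inside the support of `x`. -/
def edgeForm (G : SimpleGraph V) (x : V → ZMod 2) : ZMod 2 := x ⬝ᵥ upperAdj G *ᵥ x

set_option linter.unusedSectionVars false in
theorem edgeForm_add (G : SimpleGraph V) (x y : V → ZMod 2) :
    edgeForm G (x + y) = edgeForm G x + edgeForm G y +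
      x ⬝ᵥ (Matrix.of fun u v => if G.Adj u v then (1 : ZMod 2) else 0) *ᵥ y := by
  have h : y ⬝ᵥ upperAdj G *ᵥ x = x ⬝ᵥ (upperAdj G)ᵀ *ᵥ y := by
    rw [dotProduct_mulVec, dotProduct_comm, mulVec_transpose]
  rw [← upperAdj_add_transpose, add_mulVec, dotProduct_add, ← h]
  simp only [edgeForm, mulVec_add, dotProduct_add, add_dotProduct]
  ring

set_option linter.unusedSectionVars false in
theorem delta_eq_single (i : V) : delta i = Pi.single i 1 := by
  ext v
  simp [delta, Pi.single_apply]

theorem edgeForm_add_delta (G : SimpleGraph V) (x : V → ZMod 2) (i : V) :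
    edgeForm G (x + delta i) =
      edgeForm G x + ∑ j ∈ univ.filter (fun j => G.Adj i j), x j := by
  have h0 : edgeForm G (delta i) = 0 := by
    simp [edgeForm, delta_eq_single, upperAdj]
  rw [edgeForm_add, h0, add_zero, delta_eq_single]
  congr 1
  simp [dotProduct, sum_filter, G.adj_comm i]

/-- The matrix whose columns are the (unnormalized) graph basis vectors `Z^a |G⟩`. -/
def graphBasis (G : SimpleGraph V) : Matrix (V → ZMod 2) (V → ZMod 2) ℂ :=
  Matrix.of fun x a => parSign (edgeForm G x + x ⬝ᵥ a)

theorem conjTranspose_graphBasis_mul (G : SimpleGraph V) :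
    (graphBasis G)ᴴ * graphBasis G = (2 : ℂ) ^ Fintype.card V • 1 := by
  ext a b
  have h : ∀ x : V → ZMod 2, star (parSign (edgeForm G x + x ⬝ᵥ a)) *
      parSign (edgeForm G x + x ⬝ᵥ b) = parSign (x ⬝ᵥ (a + b)) := by
    intro x
    rw [star_parSign, ← parSign_add, dotProduct_add]
    congr 1
    linear_combination CharTwo.add_self_eq_zero (edgeForm G x)
  have h2 : a + b = 0 ↔ a = b := by
    simp only [funext_iff, Pi.add_apply, Pi.zero_apply, CharTwo.add_eq_zero]
  simp only [Matrix.mul_apply, conjTranspose_apply, graphBasis, Matrix.of_apply, h,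
    sum_parSign_dotProduct, h2, Matrix.smul_apply, Matrix.one_apply, smul_eq_mul, mul_ite,
    mul_one, mul_zero]

theorem graphBasis_mul_conjTranspose (G : SimpleGraph V) :
    graphBasis G * (graphBasis G)ᴴ = (2 : ℂ) ^ Fintype.card V • 1 := by
  have h0 : (2 : ℂ) ^ Fintype.card V ≠ 0 := by positivity
  have h : ((2 : ℂ) ^ Fintype.card V)⁻¹ • (graphBasis G)ᴴ * graphBasis G = 1 := by
    rw [smul_mul, conjTranspose_graphBasis_mul, smul_smul, inv_mul_cancel₀ h0, one_smul]
  have h' := mul_eq_one_comm.mp h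
  rw [Matrix.mul_smul] at h'
  rw [← h', smul_smul, mul_inv_cancel₀ h0, one_smul]

theorem stab_mul_graphBasis (G : SimpleGraph V) (i : V) :
    stab G i * graphBasis G = graphBasis G * diagonal fun a => parSign (a i) := by
  ext x a
  rw [mul_diagonal]
  simp only [Matrix.mul_apply, stab, graphBasis, Matrix.of_apply, ite_mul, zero_mul,
    sum_ite_eq', mem_univ, if_true]
  rw [← parSign_sum, ← parSign_add,
    ← parSign_add, edgeForm_add_delta, add_dotProduct]
  congr 1
  have : delta i ⬝ᵥ a = a i := by simp [delta_eq_single]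
  rw [this]
  linear_combination CharTwo.add_self_eq_zero (∑ j ∈ univ.filter (fun j => G.Adj i j), x j)

theorem prod_stab_mul_graphBasis (G : SimpleGraph V) (l : List V) :
    (l.map fun i => (2 : ℂ)⁻¹ • (stab G i + 1)).prod * graphBasis G =
      graphBasis G * diagonal fun a => if ∀ i ∈ l, a i = 0 then 1 else 0 := by
  induction l with
  | nil => simp
  | cons i l ih =>
    rw [List.map_cons, List.prod_cons, Matrix.mul_assoc, ih, ← Matrix.mul_assoc, smul_mul,
      Matrix.add_mul, stab_mul_graphBasis, Matrix.one_mul]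
    ext x a
    simp only [mul_diagonal, Matrix.smul_apply, Matrix.add_apply, smul_eq_mul,
      List.forall_mem_cons]
    rcases zmod_two_eq (a i) with h | h
    · simp only [h, parSign_zero, true_and]
      ring
    · simp [h, parSign_one]

theorem stabProj_mul_graphBasis (G : SimpleGraph V) (W : Finset V) :
    stabProj G W * graphBasis G =
      graphBasis G * diagonal fun a => if ∀ i ∈ W, a i = 0 then 1 else 0 := by
  convert prod_stab_mul_graphBasis G W.toList using 4
  · rfl
  · simp only [mem_toList]

/-- The expectation of a stabilizer projector, in the graph basis. -/
theorem dotProduct_stabProj (G : SimpleGraph V) (W : Finset V) (ψ : (V → ZMod 2) → ℂ) :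
    star ψ ⬝ᵥ stabProj G W *ᵥ ψ =
      ((((2 : ℝ) ^ Fintype.card V)⁻¹ * ∑ a : V → ZMod 2,
        (if ∀ i ∈ W, a i = 0 then 1 else 0) * ‖((graphBasis G)ᴴ *ᵥ ψ) a‖ ^ 2 : ℝ) : ℂ) := by
  have h0 : (2 : ℂ) ^ Fintype.card V ≠ 0 := by positivity
  have h : (2 : ℂ) ^ Fintype.card V • stabProj G W = graphBasis G *
      (diagonal fun a => if ∀ i ∈ W, a i = 0 then 1 else 0) * (graphBasis G)ᴴ := by
    rw [← stabProj_mul_graphBasis, Matrix.mul_assoc, graphBasis_mul_conjTranspose,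
      Matrix.mul_smul, Matrix.mul_one]
  have h1 : (2 : ℂ) ^ Fintype.card V * (star ψ ⬝ᵥ stabProj G W *ᵥ ψ) =
      ∑ a : V → ZMod 2, (if ∀ i ∈ W, a i = 0 then 1 else 0) *
        (‖((graphBasis G)ᴴ *ᵥ ψ) a‖ : ℂ) ^ 2 := by
    rw [← smul_eq_mul, ← dotProduct_smul, ← smul_mulVec, h, ← mulVec_mulVec, ← mulVec_mulVec,
      dotProduct_mulVec, ← conjTranspose_conjTranspose (graphBasis G), ← star_mulVec,
      conjTranspose_conjTranspose, dotProduct]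
    refine sum_congr rfl fun a _ => ?_
    rw [mulVec_diagonal, Pi.star_apply, mul_left_comm, ← Complex.conj_mul']
    rfl
  rw [← mul_right_inj' h0, h1]
  push_cast
  rw [mul_inv_cancel_left₀ h0]
  refine sum_congr rfl fun a _ => ?_
  split_ifs <;> simp

theorem stabProj_empty (G : SimpleGraph V) : stabProj G ∅ = 1 := by
  simp [stabProj]

theorem IsUnit'.sum_norm_graphBasis (G : SimpleGraph V) {ψ : (V → ZMod 2) → ℂ}
    (hψ : IsUnit' ψ) :
    ((2 : ℝ) ^ Fintype.card V)⁻¹ * ∑ a : V → ZMod 2, ‖((graphBasis G)ᴴ *ᵥ ψ) a‖ ^ 2 = 1 := by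
  have h := dotProduct_stabProj G ∅ ψ
  rw [stabProj_empty, one_mulVec, show star ψ ⬝ᵥ ψ = 1 from hψ] at h
  simpa using (Complex.ofReal_injective (by simpa using h) : (1 : ℝ) = _).symm

theorem IsUnit'.sum_norm_sq {ψ : (V → ZMod 2) → ℂ} (hψ : IsUnit' ψ) :
    ∑ x, ‖ψ x‖ ^ 2 = 1 := by
  have h : star ψ ⬝ᵥ ψ = 1 := hψ
  have h' : star ψ ⬝ᵥ ψ = ((∑ x, ‖ψ x‖ ^ 2 : ℝ) : ℂ) := by
    push_cast
    exact sum_congr rfl fun x _ => by rw [← Complex.conj_mul']; rfl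
  exact_mod_cast h'.symm.trans h

/-- Autocorrelations are bounded by the squared norm. -/
theorem norm_sum_mul_star_shift_le {M : Type*} [AddCommGroup M] [Fintype M] (f : M → ℂ) (c : M) :
    ‖∑ b, f b * star (f (b + c))‖ ≤ ∑ b, ‖f b‖ ^ 2 := by
  have h1 : ∑ b, ‖f (b + c)‖ ^ 2 = ∑ b, ‖f b‖ ^ 2 :=
    Equiv.sum_comp (Equiv.addRight c) fun b => ‖f b‖ ^ 2
  have h2 : ∑ b, ‖f b‖ ^ 2 = ∑ b, (‖f b‖ ^ 2 + ‖f (b + c)‖ ^ 2) / 2 := by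
    rw [← sum_div, sum_add_distrib, h1]
    ring
  rw [h2]
  refine (norm_sum_le _ _).trans (sum_le_sum fun b _ => ?_)
  rw [norm_mul, norm_star]
  nlinarith [sq_nonneg (‖f b‖ - ‖f (b + c)‖)]

theorem card_ker_mulVec {α β : Type*} [Fintype α] [Fintype β] [DecidableEq α] [DecidableEq β]
    (Γ : Matrix α β (ZMod 2)) :
    ((univ.filter fun c : β → ZMod 2 => Γ *ᵥ c = 0).card : ℝ) =
      2 ^ Fintype.card β * (2 ^ Γ.rank)⁻¹ := by
  have h1 : (univ.filter fun c : β → ZMod 2 => Γ *ᵥ c = 0).card =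
      Nat.card (LinearMap.ker Γ.mulVecLin) := by
    rw [← Fintype.card_subtype, ← Nat.card_eq_fintype_card]
    rfl
  have h2 := LinearMap.finrank_range_add_finrank_ker Γ.mulVecLin
  rw [Module.finrank_fintype_fun_eq_card] at h2
  have h3 : Nat.card (LinearMap.ker Γ.mulVecLin) =
      2 ^ Module.finrank (ZMod 2) (LinearMap.ker Γ.mulVecLin) := by
    rw [Module.natCard_eq_pow_finrank (K := ZMod 2), Nat.card_zmod]
  rw [h1, h3, ← h2, pow_add]
  push_cast
  rw [Matrix.rank]
  field_simp

theorem sum_norm_sq_parSign_mulVec_le {α β : Type*} [Fintype α] [Fintype β]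
    [DecidableEq α] [DecidableEq β]
    (Γ : Matrix α β (ZMod 2)) (f : (β → ZMod 2) → ℂ) :
    ∑ a : α → ZMod 2, ‖∑ b, parSign (a ⬝ᵥ Γ *ᵥ b) * f b‖ ^ 2 ≤
      2 ^ (Fintype.card α + Fintype.card β) * (2 ^ Γ.rank)⁻¹ * ∑ b, ‖f b‖ ^ 2 := by
  have key : ((∑ a : α → ZMod 2, ‖∑ b, parSign (a ⬝ᵥ Γ *ᵥ b) * f b‖ ^ 2 : ℝ) : ℂ) =
      2 ^ Fintype.card α * ∑ c ∈ univ.filter (fun c : β → ZMod 2 => Γ *ᵥ c = 0),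
        ∑ b, f b * star (f (b + c)) := by
    push_cast
    have hterm : ∀ (a : α → ZMod 2) (b c : β → ZMod 2),
        parSign (a ⬝ᵥ Γ *ᵥ b) * f b * star (parSign (a ⬝ᵥ Γ *ᵥ (b + c)) * f (b + c)) =
          parSign (a ⬝ᵥ Γ *ᵥ c) * (f b * star (f (b + c))) := by
      intro a b c
      have h : parSign (a ⬝ᵥ Γ *ᵥ b) * parSign (a ⬝ᵥ Γ *ᵥ (b + c)) =
          parSign (a ⬝ᵥ Γ *ᵥ c) := by
        rw [← parSign_add, mulVec_add, dotProduct_add, ← add_assoc,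
          CharTwo.add_self_eq_zero, zero_add]
      rw [star_mul', star_parSign, ← h]
      ring
    have hsq : ∀ a : α → ZMod 2, (‖∑ b, parSign (a ⬝ᵥ Γ *ᵥ b) * f b‖ : ℂ) ^ 2 =
        ∑ c, parSign (a ⬝ᵥ Γ *ᵥ c) * ∑ b, f b * star (f (b + c)) := by
      intro a
      rw [← Complex.mul_conj', starRingEnd_apply, star_sum, sum_mul_sum]
      simp_rw [mul_sum, ← hterm]
      rw [sum_comm (s := (univ : Finset (β → ZMod 2)))
        (f := fun c b => parSign (a ⬝ᵥ Γ *ᵥ b) * f b *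
          star (parSign (a ⬝ᵥ Γ *ᵥ (b + c)) * f (b + c)))]
      refine sum_congr rfl fun b _ => ?_
      exact (Equiv.sum_comp (Equiv.addLeft b) fun c => parSign (a ⬝ᵥ Γ *ᵥ b) * f b *
        star (parSign (a ⬝ᵥ Γ *ᵥ c) * f c)).symm
    simp_rw [hsq]
    rw [sum_comm, mul_sum, sum_filter]
    refine sum_congr rfl fun c _ => ?_
    rw [← sum_mul, sum_parSign_dotProduct]
    split_ifs <;> simp
  have hnn : 0 ≤ ∑ a : α → ZMod 2, ‖∑ b, parSign (a ⬝ᵥ Γ *ᵥ b) * f b‖ ^ 2 :=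
    sum_nonneg fun _ _ => sq_nonneg _
  rw [← Complex.norm_of_nonneg hnn, key, norm_mul, norm_pow, Complex.norm_ofNat, pow_add,
    mul_assoc, mul_assoc]
  refine mul_le_mul_of_nonneg_left ?_ (by positivity)
  rw [← mul_assoc, ← card_ker_mulVec, ← nsmul_eq_mul]
  refine (norm_sum_le _ _).trans (sum_le_card_nsmul _ _ _ fun c _ => ?_)
  exact norm_sum_mul_star_shift_le f c

/-- Gluing identifies labels on `A` and on its complement with labels on `V`. -/
def glueEquiv (A : Finset V) :
    (({v // v ∈ A} → ZMod 2) × ({v // v ∉ A} → ZMod 2)) ≃ (V → ZMod 2) where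
  toFun p := glue A p.1 p.2
  invFun x := (restrictTo A x, restrictOut A x)
  left_inv p := by
    ext v
    · simp [restrictTo, glue, v.2]
    · simp [restrictOut, glue, v.2]
  right_inv x := by
    ext v
    by_cases h : v ∈ A <;> simp [restrictTo, restrictOut, glue, h]

theorem sum_glue {R : Type*} [AddCommMonoid R] (A : Finset V) (f : (V → ZMod 2) → R) :
    ∑ x, f x = ∑ a, ∑ b, f (glue A a b) := by
  rw [← Fintype.sum_prod_type', ← Equiv.sum_comp (glueEquiv A)]
  rfl

theorem sum_eq_sum_mem_add_sum_notMem {R : Type*} [AddCommMonoid R] (A : Finset V) (f : V → R) :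
    ∑ v, f v = ∑ v : {v // v ∈ A}, f v + ∑ v : {v // v ∉ A}, f v := by
  rw [← Fintype.sum_subtype_add_sum_subtype (· ∈ A)]
  congr!

theorem edgeForm_glue (G : SimpleGraph V) (A : Finset V) (a : {v // v ∈ A} → ZMod 2)
    (b : {v // v ∉ A} → ZMod 2) :
    edgeForm G (glue A a b) =
      edgeForm G (glue A a 0) + edgeForm G (glue A 0 b) + a ⬝ᵥ gammaMat G A *ᵥ b := by
  have h : glue A a b = glue A a 0 + glue A 0 b := by
    ext v
    by_cases hv : v ∈ A <;> simp [glue, hv]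
  rw [h, edgeForm_add]
  congr 1
  simp only [dotProduct, mulVec]
  rw [sum_eq_sum_mem_add_sum_notMem A]
  have h0 : ∀ v : {v // v ∉ A}, glue A a 0 v = 0 := fun v => by simp [glue, v.2]
  simp only [h0, zero_mul, sum_const_zero, add_zero]
  refine sum_congr rfl fun u _ => ?_
  rw [sum_eq_sum_mem_add_sum_notMem A]
  have h1 : ∀ v : {v // v ∈ A}, glue A 0 b v = 0 := fun v => by simp [glue, v.2]
  simp only [h1, mul_zero, sum_const_zero, zero_add]
  have h2 : glue A a 0 u = a u := by simp [glue, u.2]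
  have h3 : ∀ v : {v // v ∉ A}, glue A 0 b v = b v := fun v => by simp [glue, v.2]
  simp only [h2, h3, gammaMat, Matrix.of_apply]

/-- A unit product vector across `A` has squared overlap at most `2 ^ (-r(A))` with the graph
state. -/
theorem IsProdVec.norm_sq_graphBasis_le (G : SimpleGraph V) {A : Finset V}
    {ψ : (V → ZMod 2) → ℂ} (hA : IsProdVec A ψ) (hψ : IsUnit' ψ) :
    ‖((graphBasis G)ᴴ *ᵥ ψ) 0‖ ^ 2 ≤ 2 ^ Fintype.card V * (2 ^ gRank G A)⁻¹ := by
  obtain ⟨φ, χ, h⟩ := hA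
  have hg : ∀ a b, ψ (glue A a b) = φ a * χ b := fun a b => by
    rw [h]
    have := (glueEquiv A).left_inv (a, b)
    exact congrArg₂ (fun s t => φ s * χ t) (congrArg Prod.fst this) (congrArg Prod.snd this)
  have hcard : Fintype.card {v // v ∈ A} + Fintype.card {v // v ∉ A} = Fintype.card V := by
    rw [← Fintype.card_sum]
    exact Fintype.card_congr (Equiv.sumCompl (· ∈ A))
  have hnorm : (∑ a, ‖φ a‖ ^ 2) * ∑ b, ‖χ b‖ ^ 2 = 1 := by
    rw [← hψ.sum_norm_sq, sum_glue A, sum_mul_sum]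
    simp only [hg, norm_mul, mul_pow]
  set f : ({v // v ∉ A} → ZMod 2) → ℂ := fun b => parSign (edgeForm G (glue A 0 b)) * χ b
    with hf
  have hfn : ∑ b, ‖f b‖ ^ 2 = ∑ b, ‖χ b‖ ^ 2 := by
    simp only [hf, norm_mul, norm_parSign, one_mul]
  have hexp : ((graphBasis G)ᴴ *ᵥ ψ) 0 =
      ∑ a, parSign (edgeForm G (glue A a 0)) * φ a *
        ∑ b, parSign (a ⬝ᵥ gammaMat G A *ᵥ b) * f b := by
    simp only [mulVec, dotProduct, conjTranspose_apply]
    rw [sum_glue A]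
    refine sum_congr rfl fun a _ => ?_
    rw [mul_sum]
    refine sum_congr rfl fun b _ => ?_
    rw [graphBasis, Matrix.of_apply, star_parSign, dotProduct_zero, add_zero, edgeForm_glue,
      parSign_add, parSign_add, hg, hf]
    simp only [mulVec, dotProduct]
    ring
  calc ‖((graphBasis G)ᴴ *ᵥ ψ) 0‖ ^ 2
      ≤ (∑ a, ‖φ a‖ * ‖∑ b, parSign (a ⬝ᵥ gammaMat G A *ᵥ b) * f b‖) ^ 2 := by
        rw [hexp]
        gcongr
        refine (norm_sum_le _ _).trans_eq (sum_congr rfl fun a _ => ?_)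
        rw [norm_mul, norm_mul, norm_parSign, one_mul]
    _ ≤ (∑ a, ‖φ a‖ ^ 2) * ∑ a, ‖∑ b, parSign (a ⬝ᵥ gammaMat G A *ᵥ b) * f b‖ ^ 2 :=
        sum_mul_sq_le_sq_mul_sq _ _ _
    _ ≤ (∑ a, ‖φ a‖ ^ 2) * (2 ^ (Fintype.card {v // v ∈ A} + Fintype.card {v // v ∉ A}) *
          (2 ^ (gammaMat G A).rank)⁻¹ * ∑ b, ‖f b‖ ^ 2) := by
        gcongr
        exact sum_norm_sq_parSign_mulVec_le _ _
    _ = ((∑ a, ‖φ a‖ ^ 2) * ∑ b, ‖χ b‖ ^ 2) *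
          (2 ^ Fintype.card V * (2 ^ gRank G A)⁻¹) := by
        rw [hfn, hcard, gRank]
        ring
    _ = 2 ^ Fintype.card V * (2 ^ gRank G A)⁻¹ := by rw [hnorm, one_mul]

/-- If the sets `C l` cover `V`, at most `k - 1` of them avoid the support of a nonzero `a`. -/
theorem sum_indicator_le {k : ℕ} (C : Fin k → Finset V) (hC : univ.biUnion C = univ)
    (a : V → ZMod 2) :
    (∑ l, if ∀ i ∈ C l, a i = 0 then (1 : ℝ) else 0) ≤ (k : ℝ) - 1 + if a = 0 then 1 else 0 := by
  have hle : ∀ l, (if ∀ i ∈ C l, a i = 0 then (1 : ℝ) else 0) ≤ 1 := fun l => by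
    split_ifs <;> norm_num
  split_ifs with ha
  · simpa using sum_le_sum fun l (_ : l ∈ univ) => hle l
  · obtain ⟨i, hi⟩ := Function.ne_iff.mp ha
    obtain ⟨l, -, hl⟩ := mem_biUnion.mp (hC ▸ mem_univ i)
    have h0 : (if ∀ i ∈ C l, a i = 0 then (1 : ℝ) else 0) = 0 := if_neg fun h => hi (h i hl)
    rw [← add_sum_erase _ _ (mem_univ l), h0, zero_add, add_zero]
    have h1 := sum_le_sum fun j (_ : j ∈ univ.erase l) => hle j
    have h2 : ((univ.erase l).card : ℝ) = (k : ℝ) - 1 := by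
      rw [cast_card_erase_of_mem (mem_univ l), card_univ, Fintype.card_fin]
    simpa only [sum_const, nsmul_eq_mul, mul_one, h2] using h1

/-- The operator inequality `∑ l, P_l ≤ (k - 1) + |G⟩⟨G|`, evaluated on a unit vector. -/
theorem IsUnit'.exists_sum_stabProj_eq (G : SimpleGraph V) {k : ℕ} (C : Fin k → Finset V)
    (hC : univ.biUnion C = univ) {ψ : (V → ZMod 2) → ℂ} (hψ : IsUnit' ψ) :
    ∃ t : ℝ, ∑ l, star ψ ⬝ᵥ stabProj G (C l) *ᵥ ψ = (t : ℂ) ∧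
      t ≤ (k : ℝ) - 1 + (2 ^ Fintype.card V)⁻¹ * ‖((graphBasis G)ᴴ *ᵥ ψ) 0‖ ^ 2 := by
  refine ⟨_, by simp only [dotProduct_stabProj]; rw [← Complex.ofReal_sum], ?_⟩
  rw [← mul_sum, sum_comm]
  simp only [← sum_mul]
  calc _ ≤ ((2 : ℝ) ^ Fintype.card V)⁻¹ * ∑ a : V → ZMod 2,
        ((k : ℝ) - 1 + if a = 0 then 1 else 0) * ‖((graphBasis G)ᴴ *ᵥ ψ) a‖ ^ 2 := by
        gcongr with a
        exact sum_indicator_le C hC a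
    _ = _ := by
        simp only [add_mul, sum_add_distrib, ite_mul, one_mul, zero_mul, sum_ite_eq', mem_univ,
          if_true, ← mul_sum, mul_add]
        rw [mul_left_comm, hψ.sum_norm_graphBasis, mul_one]

theorem trace_mul_vecMulVec_star {n : Type*} [Fintype n] (M : Matrix n n ℂ) (v : n → ℂ) :
    (M * vecMulVec v (star v)).trace = star v ⬝ᵥ M *ᵥ v := by
  rw [mul_vecMulVec, trace_vecMulVec, dotProduct_comm]

/-- Theorem 1, genuine-entanglement witness: for a proper `k`-coloring `C` of `G` with
projectors `P_l = ∏_{i ∈ C l} (S_i + I)/2`, and a partition `P` of `V` into `m ≥ 2`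
nonempty parts, every `P`-bi-separable density matrix `ρ` satisfies
`∑_l Tr(P_l ρ) ≤ k - 1 + max_A 2^{-r(A)}`. -/
theorem witness_biSep (G : SimpleGraph V) {k : ℕ} (C : Fin k → Finset V)
    (hC : IsColoring G C) {m : ℕ} (hm : 2 ≤ m)
    (P : Fin m → Finset V) (hP : IsPartition P)
    (ρ : Matrix (V → ZMod 2) (V → ZMod 2) ℂ) (hρd : IsDensity ρ) (hρ : BiSep P ρ) :
    ∑ l, (stabProj G (C l) * ρ).trace ≤
      (((k : ℝ) - 1 + ⨆ S : {S : Finset (Fin m) // S.Nonempty ∧ S ≠ univ},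
        ((2 : ℝ) ^ gRank G (S.1.biUnion P))⁻¹ : ℝ) : ℂ) := by
  obtain ⟨M, p, ψ, hp, hp1, hψ, hsep, rfl⟩ := hρ
  set B : ℝ := (k : ℝ) - 1 + ⨆ S : {S : Finset (Fin m) // S.Nonempty ∧ S ≠ univ},
    ((2 : ℝ) ^ gRank G (S.1.biUnion P))⁻¹ with hB
  have hpure : ∀ i, ∃ t : ℝ, ∑ l, star (ψ i) ⬝ᵥ stabProj G (C l) *ᵥ ψ i = (t : ℂ) ∧ t ≤ B := by
    intro i
    obtain ⟨t, ht, hle⟩ := (hψ i).exists_sum_stabProj_eq G C hC.2.1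
    obtain ⟨S, hS, hS', hprod⟩ := hsep i
    refine ⟨t, ht, hle.trans ?_⟩
    have h1 := hprod.norm_sq_graphBasis_le G (hψ i)
    have h2 : ((2 : ℝ) ^ gRank G (S.biUnion P))⁻¹ ≤ _ :=
      le_ciSup (f := fun S : {S : Finset (Fin m) // S.Nonempty ∧ S ≠ univ} =>
        ((2 : ℝ) ^ gRank G (S.1.biUnion P))⁻¹) (Set.finite_range _).bddAbove ⟨S, hS, hS'⟩
    rw [hB]
    gcongr
    refine le_trans ?_ h2
    rwa [inv_mul_le_iff₀ (by positivity)]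
  choose t ht htB using hpure
  have hsum : ∑ l, (stabProj G (C l) * ∑ i, (p i : ℂ) • vecMulVec (ψ i) (star (ψ i))).trace =
      ((∑ i, p i * t i : ℝ) : ℂ) := by
    simp only [Matrix.mul_sum, trace_sum, Matrix.mul_smul, trace_smul, trace_mul_vecMulVec_star,
      smul_eq_mul]
    rw [sum_comm]
    push_cast
    exact sum_congr rfl fun i _ => by rw [← mul_sum, ht]
  rw [hsum, Complex.real_le_real]
  calc ∑ i, p i * t i ≤ ∑ i, p i * B :=
        sum_le_sum fun i _ => mul_le_mul_of_nonneg_left (htB i) (hp i)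
    _ = B := by rw [← sum_mul, hp1, one_mul]
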